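/- Let b(n) denote the number of partition triples π = (π₁, π₂, π₃) of n such that π₁ consists of distinct odd parts, and π₂ and π₃ consist of parts divisible by 4 (with b(0) = 1). Then for all n ≥ 0, b(81n + 51) ≡ −b(9n + 6) (mod 3). -/

import Mathlib

open PowerSeries

/-- `bTriple n` is the number of partition triples `(π₁, π₂, π₃)` of `n` such that
`π₁` has distinct odd parts and all parts of `π₂` and `π₃` are (positive and)
divisible by `4`. -/
noncomputable def bTriple (n : ℕ) : ℕ :=
  Nat.card {t : Multiset ℕ × Multiset ℕ × Multiset ℕ //
    t.1.sum + t.2.1.sum + t.2.2.sum = n ∧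
    t.1.Nodup ∧ (∀ x ∈ t.1, Odd x) ∧
    (∀ x ∈ t.2.1, 0 < x ∧ 4 ∣ x) ∧
    (∀ x ∈ t.2.2, 0 < x ∧ 4 ∣ x)}


set_option autoImplicit false

/-- The coefficient ring. -/
abbrev BT.S := PowerSeries (ZMod 3)

namespace BT

open Finset

theorem eq_of_dvd {F G : S} (h : ∀ N : ℕ, (X : S) ^ N ∣ F - G) : F = G := by
  ext n
  have := (X_pow_dvd_iff.mp (h (n+1))) n (Nat.lt_succ_self n)
  rw [map_sub] at this
  exact sub_eq_zero.mp this

theorem dvd_trans_sub {N : ℕ} {F G H : S} (h1 : (X : S) ^ N ∣ F - G) (h2 : (X : S) ^ N ∣ G - H) :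
    (X : S) ^ N ∣ F - H := by
  have := dvd_add h1 h2
  simpa using this

theorem dvd_mul_sub {N : ℕ} {F G F' G' : S} (h1 : (X : S) ^ N ∣ F - G)
    (h2 : (X : S) ^ N ∣ F' - G') : (X : S) ^ N ∣ F * F' - G * G' := by
  have : F * F' - G * G' = (F - G) * F' + G * (F' - G') := by ring
  rw [this]
  exact dvd_add (h1.mul_right _) (h2.mul_left _)

/-- good factors -/
def Good (g : ℕ → S) : Prop := ∀ k, (X : S) ^ (k+1) ∣ g k - 1

/-- infinite product -/
noncomputable def P (g : ℕ → S) : S := PowerSeries.mk fun n => coeff n (∏ k ∈ range n, g k)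

theorem prod_congr_le {g : ℕ → S} (hg : Good g) {n M : ℕ} (h : n ≤ M) :
    (X : S) ^ (n+1) ∣ (∏ k ∈ range M, g k) - ∏ k ∈ range n, g k := by
  induction M, h using Nat.le_induction with
  | base => simp
  | succ M hM ih =>
    rw [prod_range_succ]
    refine dvd_trans_sub ?_ ih
    have : (∏ k ∈ range M, g k) * g M - ∏ k ∈ range M, g k
      = (∏ k ∈ range M, g k) * (g M - 1) := by ring
    rw [this]
    exact ((pow_dvd_pow _ (by omega)).trans (hg M)).mul_left _

theorem P_congr {g : ℕ → S} (hg : Good g) {N M : ℕ} (h : N ≤ M) :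
    (X : S) ^ N ∣ P g - ∏ k ∈ range M, g k := by
  rw [X_pow_dvd_iff]
  intro m hm
  have := X_pow_dvd_iff.mp (prod_congr_le hg (n := m) (M := M) (by omega)) m (by omega)
  rw [map_sub] at this ⊢
  rw [P, coeff_mk, sub_eq_zero]
  exact (sub_eq_zero.mp this).symm

theorem P_unique {g : ℕ → S} (hg : Good g) {F : S}
    (h : ∀ N, ∃ M, N ≤ M ∧ (X : S) ^ N ∣ F - ∏ k ∈ range M, g k) : F = P g := by
  apply eq_of_dvd
  intro N
  obtain ⟨M, hM, h⟩ := h N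
  have := dvd_sub h (P_congr hg hM)
  simpa using this

theorem Good.mul {g h : ℕ → S} (hg : Good g) (hh : Good h) : Good (fun k => g k * h k) := by
  intro k
  have := dvd_mul_sub (hg k) (hh k)
  simpa using this

theorem Good.pow {g : ℕ → S} (hg : Good g) (e : ℕ → ℕ) : Good (fun k => g k ^ e k) := by
  intro k
  have := sub_dvd_pow_sub_pow (g k) 1 (e k)
  rw [one_pow] at this
  exact (hg k).trans this

theorem P_mul {g h : ℕ → S} (hg : Good g) (hh : Good h) :
    P (fun k => g k * h k) = P g * P h := by
  symm
  apply P_unique (hg.mul hh)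
  intro N
  refine ⟨N, le_rfl, ?_⟩
  rw [prod_mul_distrib]
  exact dvd_mul_sub (P_congr hg le_rfl) (P_congr hh le_rfl)

theorem P_ne {g : ℕ → S} : P g ≠ 0 := by
  intro h
  have := congrArg (coeff 0) h
  rw [P, coeff_mk] at this
  simp at this

theorem good_X (u : S) (f : ℕ → ℕ) (hf : ∀ k, k + 1 ≤ f k) : Good (fun k => 1 + u * X ^ f k) := by
  intro k
  rw [add_sub_cancel_left]
  exact (pow_dvd_pow _ (hf k)).mul_left _

theorem good_X' (f : ℕ → ℕ) (hf : ∀ k, k + 1 ≤ f k) : Good (fun k => 1 - X ^ f k) := by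
  have := good_X (-1) f hf
  simpa [sub_eq_add_neg] using this

/-- eta-type product with multiplicities -/
noncomputable def m (e : ℕ → ℕ) : S := P (fun k => (1 - X ^ (k+1)) ^ e (k+1))

theorem good_m (e : ℕ → ℕ) : Good (fun k => (1 - X ^ (k+1)) ^ e (k+1)) :=
  (good_X' (fun k => k+1) (fun _ => le_rfl)).pow (fun k => e (k+1))

theorem m_ne (e : ℕ → ℕ) : m e ≠ 0 := P_ne

theorem m_add (e e' : ℕ → ℕ) : m e * m e' = m (fun n => e n + e' n) := by
  unfold m
  rw [← P_mul (good_m e) (good_m e')]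
  simp only [pow_add]

theorem reindex (d r : ℕ) (hr : 1 ≤ r) (hd : r ≤ d) (e : ℕ → ℕ) :
    P (fun k => (1 - X ^ (d * k + r)) ^ e k) =
      m (fun n => if n % d = r % d then e ((n - r) / d) else 0) := by
  have hd0 : 0 < d := by omega
  refine P_unique (good_m (fun n => if n % d = r % d then e ((n - r) / d) else 0)) ?_
  intro N
  refine ⟨d * N, Nat.le_mul_of_pos_left _ hd0, ?_⟩
  have key : ∀ M, ∏ k ∈ range (d * M), ((1 : S) - X ^ (k+1)) ^
      (if (k+1) % d = r % d then e ((k + 1 - r) / d) else 0) =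
      ∏ k ∈ range M, (1 - X ^ (d * k + r)) ^ e k := by
    intro M
    induction M with
    | zero => simp
    | succ M ih =>
      rw [mul_add, mul_one, prod_range_add, ih, prod_range_succ]
      congr 1
      rw [prod_eq_single (r - 1)]
      · have h1 : d * M + (r - 1) + 1 = d * M + r := by omega
        rw [h1, Nat.mul_add_mod, if_pos rfl, Nat.add_sub_cancel, Nat.mul_div_cancel_left _ hd0]
      · intro i hi hne
        rw [if_neg, pow_zero]
        rw [mem_range] at hi
        rw [add_assoc, Nat.mul_add_mod]
        intro h
        rcases Nat.lt_or_ge (i+1) d with h1 | h1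
        · rcases Nat.lt_or_ge r d with h2 | h2
          · rw [Nat.mod_eq_of_lt h1, Nat.mod_eq_of_lt h2] at h
            omega
          · have : r = d := by omega
            subst this
            rw [Nat.mod_eq_of_lt h1, Nat.mod_self] at h
            omega
        · have h3 : i + 1 = d := by omega
          rw [h3, Nat.mod_self] at h
          rcases Nat.lt_or_ge r d with h2 | h2
          · rw [Nat.mod_eq_of_lt h2] at h
            omega
          · omega
      · intro h
        exact absurd (mem_range.mpr (by omega)) h
  rw [key]
  refine P_congr (Good.pow (good_X' _ ?_) e) le_rfl
  intro k
  have : k ≤ d * k := Nat.le_mul_of_pos_left _ hd0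
  omega

theorem reindex' (d r : ℕ) (hr : 1 ≤ r) (hd : r ≤ d) :
    P (fun k => 1 - X ^ (d * k + r)) = m (fun n => if n % d = r % d then 1 else 0) := by
  have := reindex d r hr hd (fun _ => 1)
  simpa using this

instance : CharP S 3 :=
  charP_of_injective_ringHom (f := (PowerSeries.C : ZMod 3 →+* S)) PowerSeries.C_injective 3

theorem sub_cube (F G : S) : (F - G) ^ 3 = F ^ 3 - G ^ 3 := by
  have := sub_pow_char (R := S) F G (p := 3)
  exact this

theorem add_cube (F G : S) : (F + G) ^ 3 = F ^ 3 + G ^ 3 := by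
  have := add_pow_char (R := S) F G (p := 3)
  exact this

theorem dvd_cube {N : ℕ} {F G : S} (h : (X : S) ^ N ∣ F - G) : (X : S) ^ N ∣ F ^ 3 - G ^ 3 := by
  rw [← sub_cube]
  exact h.trans (dvd_pow_self _ (by norm_num))

theorem m_cube (e : ℕ → ℕ) :
    m e ^ 3 = m (fun n => if n % 3 = 0 then e (n / 3) else 0) := by
  have h := reindex 3 3 (by norm_num) le_rfl (fun k => e (k+1))
  have h2 : (fun n => if n % 3 = 3 % 3 then e ((n - 3) / 3 + 1) else 0) (0:ℕ) = e 1 := by simp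
  have h3 : P (fun k => (1 - X ^ (3 * k + 3)) ^ e (k+1)) = m e ^ 3 := by
    rw [pow_succ, pow_two, m, ← P_mul (good_m e) (good_m e),
      ← P_mul ((good_m e).mul (good_m e)) (good_m e)]
    congr 1
    funext k
    rw [← mul_pow, ← mul_pow, ← pow_two, ← pow_succ, sub_cube, one_pow, ← pow_mul]
    congr 3
    ring
  rw [← h3, h]
  unfold m
  congr 1
  funext k
  congr 1
  by_cases h : (k+1) % 3 = 0
  · simp only [h, Nat.mod_self, if_true]
    congr 1
    omega
  · simp only [h, Nat.mod_self, if_false]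

end BT

namespace BT

open Finset

/-- triangular numbers indexed by integers -/
def tri (j : ℤ) : ℕ := (j * (j + 1) / 2).toNat

theorem tri_cast (j : ℤ) : 2 * (tri j : ℤ) = j * (j + 1) := by
  have h1 : 0 ≤ j * (j + 1) := by
    rcases le_or_gt 0 j with h | h
    · positivity
    · exact mul_nonneg_of_nonpos_of_nonpos h.le (by omega)
  have h2 : 2 ∣ j * (j + 1) := (Int.even_mul_succ_self j).two_dvd
  unfold tri
  rw [Int.toNat_of_nonneg (by omega)]
  omega

theorem tri_sum (j : ℤ) : tri j + tri (j - 1) = j.natAbs * j.natAbs := by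
  have h1 := tri_cast j
  have h2 := tri_cast (j - 1)
  zify
  rw [abs_mul_abs_self]
  linarith

/-- bilateral infinite sum -/
noncomputable def sm (T : ℤ → S) : S :=
  PowerSeries.mk fun n => coeff n (∑ j ∈ Icc (-(n : ℤ)) n, T j)

/-- good terms -/
def GoodT (T : ℤ → S) : Prop := ∀ j : ℤ, (X : S) ^ j.natAbs ∣ T j

theorem sum_congr_le {T : ℤ → S} (hT : GoodT T) {n : ℕ} {A : Finset ℤ}
    (h : Icc (-(n : ℤ)) n ⊆ A) :
    (X : S) ^ (n+1) ∣ ∑ j ∈ A, T j - ∑ j ∈ Icc (-(n : ℤ)) n, T j := by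
  rw [← sum_sdiff h, add_sub_cancel_right]
  apply dvd_sum
  intro j hj
  rw [mem_sdiff, mem_Icc] at hj
  exact (pow_dvd_pow _ (by omega)).trans (hT j)

theorem sm_congr {T : ℤ → S} (hT : GoodT T) {N : ℕ} {A : Finset ℤ}
    (h : Icc (-(N : ℤ)) N ⊆ A) : (X : S) ^ N ∣ sm T - ∑ j ∈ A, T j := by
  rw [X_pow_dvd_iff]
  intro m hm
  have h' : Icc (-(m : ℤ)) m ⊆ A := (Icc_subset_Icc (by omega) (by omega)).trans h
  have := X_pow_dvd_iff.mp (sum_congr_le hT h') m (by omega)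
  rw [map_sub] at this ⊢
  rw [sm, coeff_mk, sub_eq_zero]
  exact (sub_eq_zero.mp this).symm

/-- theta terms -/
noncomputable def tt (a b : S) (j : ℤ) : S := a ^ tri j * b ^ tri (j - 1)

/-- theta function -/
noncomputable def theta (a b : S) : S := sm (tt a b)

theorem tt_dvd {a b : S} (ha : X ∣ a) (hb : X ∣ b) (j : ℤ) :
    (X : S) ^ (j.natAbs * j.natAbs) ∣ tt a b j := by
  rw [← tri_sum, pow_add]
  exact mul_dvd_mul (pow_dvd_pow_of_dvd ha _) (pow_dvd_pow_of_dvd hb _)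

theorem goodT_tt {a b : S} (ha : X ∣ a) (hb : X ∣ b) : GoodT (tt a b) := fun j =>
  (pow_dvd_pow _ (Nat.le_mul_self _)).trans (tt_dvd ha hb j)

/-- Gaussian binomials -/
noncomputable def gb (Q : S) : ℕ → ℕ → S
  | _, 0 => 1
  | 0, _ + 1 => 0
  | n + 1, k + 1 => gb Q n k + Q ^ (k+1) * gb Q n (k+1)

theorem gb_zero_right (Q : S) (n : ℕ) : gb Q n 0 = 1 := by cases n <;> rfl

theorem gb_succ (Q : S) (n k : ℕ) :
    gb Q (n+1) (k+1) = gb Q n k + Q ^ (k+1) * gb Q n (k+1) := rfl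

theorem gb_lt (Q : S) (n k : ℕ) (h : n < k) : gb Q n k = 0 := by
  induction n generalizing k with
  | zero => cases k with
    | zero => omega
    | succ k => rfl
  | succ n ih => cases k with
    | zero => omega
    | succ k => rw [gb_succ, ih k (by omega), ih (k+1) (by omega)]; simp

theorem gb_ratio (Q : S) (n k : ℕ) (h : k ≤ n) :
    (1 - Q ^ (k+1)) * gb Q n (k+1) = (1 - Q ^ (n - k)) * gb Q n k := by
  induction n generalizing k with
  | zero =>
    obtain rfl : k = 0 := by omega
    rw [gb_lt Q 0 1 (by omega)]; simp
  | succ n ih =>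
    cases k with
    | zero =>
      have h0 := ih 0 (by omega)
      rw [gb_succ, gb_zero_right, gb_zero_right] at *
      simp only [Nat.sub_zero, zero_add, pow_one, mul_one] at *
      rw [pow_succ']
      linear_combination Q * h0
    | succ k =>
      rw [gb_succ, gb_succ]
      have h1 := ih k (by omega)
      rw [show n + 1 - (k + 1) = n - k by omega]
      rcases Nat.lt_or_ge k n with hk | hk
      · have h2 := ih (k+1) (by omega)
        have e1 : Q ^ (k + 1 + 1) * Q ^ (n - (k+1)) = Q ^ (k+1) * Q ^ (n - k) := by
          rw [← pow_add, ← pow_add]; congr 1; omega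
        linear_combination Q ^ (k+1+1) * h2 - gb Q n (k+1) * e1 + h1
      · obtain rfl : k = n := by omega
        rw [gb_lt Q k (k+1) (by omega), gb_lt Q k (k+1+1) (by omega)]
        simp

theorem gb_succ' (Q : S) (n k : ℕ) (h : k ≤ n) :
    gb Q (n+1) (k+1) = Q ^ (n - k) * gb Q n k + gb Q n (k+1) := by
  rw [gb_succ]
  linear_combination - gb_ratio Q n k h

/-- finite `(Q;Q)_k` -/
noncomputable def qp (Q : S) (k : ℕ) : S := ∏ i ∈ range k, (1 - Q ^ (i+1))

theorem gb_qp (Q : S) (n k : ℕ) (h : k ≤ n) :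
    gb Q n k * qp Q k = ∏ i ∈ range k, (1 - Q ^ (n - i)) := by
  induction k with
  | zero => simp [gb_zero_right, qp]
  | succ k ih =>
    rw [prod_range_succ, ← ih (by omega), qp, prod_range_succ, ← qp]
    linear_combination qp Q k * gb_ratio Q n k (by omega)

theorem step_a (a b : S) (j : ℤ) (m : ℕ) (h : j ≤ m) :
    a * (a * b) ^ m * tt a b j = (a * b) ^ ((m - j).toNat) * tt a b (j + 1) := by
  have h1 := tri_cast j
  have h2 := tri_cast (j - 1)
  have h3 := tri_cast (j + 1)
  have h4 : (((m - j).toNat : ℕ) : ℤ) = m - j := Int.toNat_of_nonneg (by omega)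
  have e1 : 1 + m + tri j = (m - j).toNat + tri (j + 1) := by zify; rw [h4]; linarith
  have e2 : m + tri (j - 1) = (m - j).toNat + tri (j + 1 - 1) := by
    rw [add_sub_cancel_right]; zify; rw [h4]; linarith
  calc _ = a ^ (1 + m + tri j) * b ^ (m + tri (j - 1)) := by unfold tt; ring
    _ = _ := by rw [e1, e2]; unfold tt; ring

theorem step_b (a b : S) (j : ℤ) (m : ℕ) (h : -j ≤ m) :
    b * (a * b) ^ m * tt a b j = (a * b) ^ ((m + j).toNat) * tt a b (j - 1) := by
  have h1 := tri_cast j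
  have h2 := tri_cast (j - 1)
  have h3 := tri_cast (j - 1 - 1)
  have h4 : (((m + j).toNat : ℕ) : ℤ) = m + j := Int.toNat_of_nonneg (by omega)
  have e1 : m + tri j = (m + j).toNat + tri (j - 1) := by zify; rw [h4]; linarith
  have e2 : 1 + m + tri (j - 1) = (m + j).toNat + tri (j - 1 - 1) := by
    zify; rw [h4]; linarith
  calc _ = a ^ (m + tri j) * b ^ (1 + m + tri (j - 1)) := by unfold tt; ring
    _ = _ := by rw [e1, e2]; unfold tt; ring

theorem fin_b (a b : S) (n : ℕ) :
    ∏ k ∈ range n, (1 + b * (a * b) ^ k) =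
      ∑ i ∈ range (n + 1), gb (a * b) n i * tt a b ((i : ℤ) - n) := by
  induction n with
  | zero => simp [gb_zero_right, tt, tri]
  | succ n ih =>
    rw [prod_range_succ, ih, mul_add, mul_one]
    have h1 : ∑ i ∈ range (n + 1 + 1), gb (a * b) (n+1) i * tt a b ((i : ℤ) - (n + 1 : ℕ))
      = (∑ i ∈ range (n + 1), gb (a * b) n i * tt a b ((i : ℤ) - n)) +
        ∑ i ∈ range (n + 1 + 1), (a * b) ^ i * gb (a * b) n i *
          tt a b ((i : ℤ) - (n + 1 : ℕ)) := by
      rw [sum_range_succ', sum_range_succ' _ (n+1), ← add_assoc, ← sum_add_distrib]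
      congr 1
      · apply sum_congr rfl
        intro i _
        rw [gb_succ]
        have : (((i + 1 : ℕ) : ℤ) - (n + 1 : ℕ)) = i - n := by push_cast; ring
        rw [this]; ring
      · simp [gb_zero_right]
    rw [h1, sum_range_succ _ (n+1), gb_lt _ n (n+1) (by omega), mul_zero, zero_mul, add_zero,
      sum_mul]
    congr 1
    apply sum_congr rfl
    intro i hi
    have := step_b a b ((i : ℤ) - n) n (by omega)
    rw [show ((n : ℤ) + (i - n)).toNat = i by omega,
      show ((i : ℤ) - n - 1) = i - (n + 1 : ℕ) by push_cast; ring] at this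
    linear_combination gb (a * b) n i * this

theorem fin_ab (a b : S) (n m : ℕ) :
    (∏ k ∈ range n, (1 + b * (a * b) ^ k)) * ∏ k ∈ range m, (1 + a * (a * b) ^ k) =
      ∑ i ∈ range (n + m + 1), gb (a * b) (n + m) i * tt a b ((i : ℤ) - n) := by
  induction m with
  | zero => simp [fin_b]
  | succ m ih =>
    rw [prod_range_succ, ← mul_assoc, ih, mul_add, mul_one, ← add_assoc n m 1]
    have h1 : ∑ i ∈ range (n + m + 1 + 1), gb (a * b) (n+m+1) i * tt a b ((i : ℤ) - n)
      = (∑ i ∈ range (n + m + 1 + 1), gb (a * b) (n+m) i * tt a b ((i : ℤ) - n)) +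
        ∑ i ∈ range (n + m + 1), (a * b) ^ (n + m - i) * gb (a * b) (n+m) i *
          tt a b ((i : ℤ) - n + 1) := by
      rw [sum_range_succ', sum_range_succ' _ (n+m+1), add_right_comm (_ : S), ← sum_add_distrib]
      congr 1
      · apply sum_congr rfl
        intro i hi
        rw [mem_range] at hi
        rw [gb_succ' _ _ _ (by omega)]
        have : (((i + 1 : ℕ) : ℤ) - n) = i - n + 1 := by push_cast; ring
        rw [this]; ring
      · simp [gb_zero_right]
    rw [h1, sum_range_succ _ (n+m+1), gb_lt _ (n+m) (n+m+1) (by omega), zero_mul, add_zero,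
      sum_mul]
    congr 1
    apply sum_congr rfl
    intro i hi
    rw [mem_range] at hi
    have := step_a a b ((i : ℤ) - n) m (by omega)
    rw [show ((m : ℤ) - (i - n)).toNat = n + m - i by omega] at this
    linear_combination gb (a * b) (n + m) i * this

theorem dvd_prod_sub_one {N : ℕ} (s : Finset ℕ) (g : ℕ → S)
    (h : ∀ i ∈ s, (X : S) ^ N ∣ g i - 1) : (X : S) ^ N ∣ ∏ i ∈ s, g i - 1 := by
  induction s using Finset.induction_on with
  | empty => simp
  | insert i s hi ih =>
    rw [prod_insert hi]
    have := dvd_mul_sub (h i (mem_insert_self _ _)) (ih fun j hj => h j (mem_insert_of_mem hj))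
    simpa using this

theorem good_eu {Q : S} (hQ : X ∣ Q) : Good (fun k => 1 - Q ^ (k+1)) := by
  intro k
  rw [show (1 : S) - Q ^ (k+1) - 1 = - Q ^ (k+1) by ring, dvd_neg]
  exact pow_dvd_pow_of_dvd hQ _

theorem good_1 {c Q : S} (hc : X ∣ c) (hQ : X ∣ Q) : Good (fun k => 1 + c * Q ^ k) := by
  intro k
  rw [add_sub_cancel_left, pow_succ']
  exact mul_dvd_mul hc (pow_dvd_pow_of_dvd hQ _)

theorem gb_lim {Q : S} (hQ : X ∣ Q) (N i d : ℕ) (hi : i ≤ 2 * N) (h1 : d ≤ i + 1)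
    (h2 : d ≤ 2 * N + 1 - i) :
    (X : S) ^ d ∣ P (fun k => 1 - Q ^ (k+1)) * gb Q (2 * N) i - 1 := by
  have h3 : (X : S) ^ d ∣ P (fun k => 1 - Q ^ (k+1)) - qp Q i := by
    refine dvd_trans_sub (P_congr (good_eu hQ) (N := d) (M := d + i) (by omega)) ?_
    exact (pow_dvd_pow _ h1).trans (prod_congr_le (good_eu hQ) (by omega))
  have h4 : (X : S) ^ d ∣ qp Q i * gb Q (2 * N) i - 1 := by
    rw [mul_comm, gb_qp _ _ _ hi]
    apply dvd_prod_sub_one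
    intro k hk
    rw [mem_range] at hk
    rw [show (1 : S) - Q ^ (2 * N - k) - 1 = - Q ^ (2 * N - k) by ring, dvd_neg]
    exact (pow_dvd_pow X (by omega)).trans (pow_dvd_pow_of_dvd hQ _)
  refine dvd_trans_sub ?_ h4
  have := h3.mul_right (gb Q (2 * N) i)
  rwa [sub_mul] at this

theorem jtp {a b : S} (ha : X ∣ a) (hb : X ∣ b) :
    theta a b = P (fun k => 1 - (a * b) ^ (k+1)) * P (fun k => 1 + b * (a * b) ^ k) *
      P (fun k => 1 + a * (a * b) ^ k) := by
  have hQ : X ∣ a * b := ha.mul_right b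
  apply eq_of_dvd
  intro N
  set E := P (fun k => 1 - (a * b) ^ (k+1)) with hE
  have h1 : (X : S) ^ N ∣ theta a b - ∑ i ∈ range (N + N + 1), tt a b ((i : ℤ) - N) := by
    have := sm_congr (goodT_tt ha hb) (N := N)
      (A := (range (N + N + 1)).image (fun i : ℕ => (i : ℤ) - N)) (by
        intro j hj
        rw [mem_Icc] at hj
        rw [mem_image]
        exact ⟨(j + N).toNat, by rw [mem_range]; omega, by omega⟩)
    rw [sum_image (by intro x _ y _ h; simpa using h)] at this
    exact this
  refine dvd_trans_sub h1 ?_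
  rw [← dvd_neg, neg_sub, mul_assoc]
  refine dvd_trans_sub (G := E * ((∏ k ∈ range N, (1 + b * (a * b) ^ k)) *
      ∏ k ∈ range N, (1 + a * (a * b) ^ k))) ?_ ?_
  · rw [← mul_sub]
    exact (dvd_mul_sub (P_congr (good_1 hb hQ) le_rfl)
      (P_congr (good_1 ha hQ) le_rfl)).mul_left _
  · rw [fin_ab, mul_sum, ← sum_sub_distrib]
    apply dvd_sum
    intro i hi
    rw [mem_range] at hi
    have e : E * (gb (a * b) (N + N) i * tt a b ((i : ℤ) - N)) - tt a b ((i : ℤ) - N) =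
      (E * gb (a * b) (2 * N) i - 1) * tt a b ((i : ℤ) - N) := by
      rw [two_mul]; ring
    rw [e]
    have k1 := gb_lim hQ N i (N - ((i : ℤ) - N).natAbs) (by omega) (by omega) (by omega)
    have k2 := mul_dvd_mul k1 ((goodT_tt ha hb) ((i : ℤ) - N))
    rw [← pow_add] at k2
    exact (pow_dvd_pow _ (by omega)).trans k2

end BT

namespace BT

open Finset

/-- substitution `q ↦ -q` -/
noncomputable def Ng : S →+* S := evalNegHom

theorem Ng_X_pow (n : ℕ) : Ng (X ^ n) = (-1) ^ n * X ^ n := by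
  rw [map_pow, Ng, evalNegHom_X, neg_pow]

theorem Ng_dvd' {n : ℕ} {F : S} (h : (X : S) ^ n ∣ F) : (X : S) ^ n ∣ Ng F := by
  have := map_dvd Ng h
  rw [Ng_X_pow] at this
  exact dvd_of_mul_left_dvd this

theorem Ng_dvd {n : ℕ} {F G : S} (h : (X : S) ^ n ∣ F - G) : (X : S) ^ n ∣ Ng F - Ng G := by
  rw [← map_sub]
  exact Ng_dvd' h

theorem Good.ng {g : ℕ → S} (hg : Good g) : Good (fun k => Ng (g k)) := by
  intro k
  have := Ng_dvd (hg k)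
  rwa [map_one] at this

theorem Ng_P {g : ℕ → S} (hg : Good g) : Ng (P g) = P (fun k => Ng (g k)) := by
  apply P_unique hg.ng
  intro N
  refine ⟨N, le_rfl, ?_⟩
  rw [← map_prod]
  exact Ng_dvd (P_congr hg le_rfl)

theorem sm_unique {T : ℤ → S} (hT : GoodT T) {F : S}
    (h : ∀ N : ℕ, (X : S) ^ N ∣ F - ∑ j ∈ Icc (-(N : ℤ)) N, T j) : F = sm T := by
  apply eq_of_dvd
  intro N
  have := dvd_sub (h N) (sm_congr hT (subset_refl (Icc (-(N : ℤ)) N)))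
  simpa using this

theorem Ng_theta {a b : S} (ha : X ∣ a) (hb : X ∣ b) : Ng (theta a b) = theta (Ng a) (Ng b) := by
  have ha' : X ∣ Ng a := by
    have := Ng_dvd' (n := 1) (F := a) (by simpa using ha)
    simpa using this
  have hb' : X ∣ Ng b := by
    have := Ng_dvd' (n := 1) (F := b) (by simpa using hb)
    simpa using this
  apply sm_unique (goodT_tt ha' hb')
  intro N
  have := Ng_dvd (sm_congr (goodT_tt ha hb) (subset_refl (Icc (-(N : ℤ)) N)))
  rw [map_sum] at this
  simpa [tt, theta] using this

/-- sign -/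
noncomputable def sg (j : ℤ) : S := if Even j then 1 else -1

theorem tt_pos (r s : ℕ) (j : ℤ) :
    tt (X ^ r) (X ^ s) j = X ^ (r * tri j + s * tri (j - 1)) := by
  unfold tt
  rw [← pow_mul, ← pow_mul, pow_add]

theorem tt_neg (r s : ℕ) (j : ℤ) :
    tt (-X ^ r) (-X ^ s) j = sg j * X ^ (r * tri j + s * tri (j - 1)) := by
  unfold tt
  rw [neg_pow, neg_pow (X ^ s), ← pow_mul, ← pow_mul, pow_add]
  have : sg j = (-1) ^ tri j * (-1) ^ tri (j - 1) := by
    rw [← pow_add, tri_sum, sg]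
    split_ifs with h
    · rw [Even.neg_one_pow]
      rw [Nat.even_mul, Int.natAbs_even]
      exact Or.inl h
    · rw [Odd.neg_one_pow]
      rw [← Nat.not_even_iff_odd, Nat.even_mul, Int.natAbs_even]
      tauto
  rw [this]
  ring

theorem sg_cube (j : ℤ) : sg j ^ 3 = sg j := by
  unfold sg; split_ifs <;> norm_num

theorem sg_3 (j : ℤ) : sg (3 * j) = sg j := by
  unfold sg
  have : Even (3 * j) ↔ Even j := by rw [Int.even_iff, Int.even_iff]; omega
  simp only [this]

theorem sg_31 (j : ℤ) : sg (3 * j + 1) = - sg j := by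
  unfold sg
  have : Even (3 * j + 1) ↔ ¬ Even j := by rw [Int.even_iff, Int.even_iff]; omega
  simp only [this]
  split_ifs <;> simp_all

theorem sg_32 (j : ℤ) : sg (-(3 * j + 1)) = - sg j := by
  unfold sg
  have : Even (-(3 * j + 1)) ↔ ¬ Even j := by rw [Int.even_iff, Int.even_iff]; omega
  simp only [this]
  split_ifs <;> simp_all

theorem sum_Icc_left (F : ℤ → S) (a b : ℤ) (h : a ≤ b + 1) :
    ∑ j ∈ Icc (a - 1) b, F j = F (a - 1) + ∑ j ∈ Icc a b, F j := by
  have : Icc (a - 1) b = insert (a - 1) (Icc a b) := by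
    ext x; simp only [mem_Icc, mem_insert]; omega
  rw [this, sum_insert (by simp)]

theorem sum_Icc_right (F : ℤ → S) (a b : ℤ) (h : a ≤ b + 1) :
    ∑ j ∈ Icc a (b + 1), F j = F (b + 1) + ∑ j ∈ Icc a b, F j := by
  have : Icc a (b + 1) = insert (b + 1) (Icc a b) := by
    ext x; simp only [mem_Icc, mem_insert]; omega
  rw [this, sum_insert (by simp)]

theorem sum_Icc_both (F : ℤ → S) (M : ℕ) :
    ∑ j ∈ Icc (-((M + 1 : ℕ) : ℤ)) (M + 1 : ℕ), F j =
      F (-((M : ℤ) + 1)) + F ((M : ℤ) + 1) + ∑ j ∈ Icc (-(M : ℤ)) M, F j := by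
  have e : (-((M + 1 : ℕ) : ℤ)) = -(M : ℤ) - 1 := by push_cast; ring
  rw [e, sum_Icc_left _ _ _ (by omega)]
  push_cast
  rw [sum_Icc_right _ _ _ (by omega)]
  rw [show -((M : ℤ) + 1) = -(M : ℤ) - 1 by ring]
  ring

theorem split3 (F : ℤ → S) (M : ℕ) :
    ∑ j ∈ Icc (-(3 * (M : ℤ) + 1)) (3 * M + 1), F j =
      ∑ j ∈ Icc (-(M : ℤ)) M, (F (3 * j) + F (3 * j + 1) + F (-(3 * j + 1))) := by
  induction M with
  | zero =>
    have : Icc (-(3 * ((0 : ℕ) : ℤ) + 1)) (3 * ((0 : ℕ) : ℤ) + 1) = {-1, 0, 1} := by decide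
    rw [this]
    simp
    ring
  | succ M ih =>
    rw [sum_Icc_both, ← ih]
    have e1 : -(3 * ((M + 1 : ℕ) : ℤ) + 1) = -(3 * (M : ℤ) + 1) - 1 - 1 - 1 := by push_cast; ring
    have e2 : (3 * ((M + 1 : ℕ) : ℤ) + 1) = (3 * (M : ℤ) + 1) + 1 + 1 + 1 := by push_cast; ring
    rw [e1, e2, sum_Icc_left _ _ _ (by omega), sum_Icc_left _ _ _ (by omega),
      sum_Icc_left _ _ _ (by omega), sum_Icc_right _ _ _ (by omega),
      sum_Icc_right _ _ _ (by omega), sum_Icc_right _ _ _ (by omega)]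
    ring_nf

theorem split2 (F : ℤ → S) (M : ℕ) :
    ∑ j ∈ Icc (-(2 * (M : ℤ) + 1)) (2 * M), F j =
      ∑ j ∈ Icc (-(M : ℤ)) M, (F (2 * j) + F (-(2 * j + 1))) := by
  induction M with
  | zero =>
    have : Icc (-(2 * ((0 : ℕ) : ℤ) + 1)) (2 * ((0 : ℕ) : ℤ)) = {-1, 0} := by decide
    rw [this]
    simp
    ring
  | succ M ih =>
    rw [sum_Icc_both, ← ih]
    have e1 : -(2 * ((M + 1 : ℕ) : ℤ) + 1) = -(2 * (M : ℤ) + 1) - 1 - 1 := by push_cast; ring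
    have e2 : (2 * ((M + 1 : ℕ) : ℤ)) = (2 * (M : ℤ)) + 1 + 1 := by push_cast; ring
    rw [e1, e2, sum_Icc_left _ _ _ (by omega), sum_Icc_left _ _ _ (by omega),
      sum_Icc_right _ _ _ (by omega), sum_Icc_right _ _ _ (by omega)]
    ring_nf

theorem sum_cube (A : Finset ℤ) (F : ℤ → S) : (∑ j ∈ A, F j) ^ 3 = ∑ j ∈ A, F j ^ 3 :=
  sum_pow_char 3 A F

theorem X_dvd_pow {r : ℕ} (h : 1 ≤ r) : (X : S) ∣ X ^ r := dvd_pow_self _ (by omega)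

theorem X_dvd_npow {r : ℕ} (h : 1 ≤ r) : (X : S) ∣ -X ^ r := (dvd_neg).mpr (X_dvd_pow h)

/-- `ψ(q)` -/
noncomputable def p : S := theta (X ^ 3) (X ^ 1)
/-- `ψ(-q)` -/
noncomputable def s : S := theta (-X ^ 3) (-X ^ 1)
/-- `f(q,q²)` -/
noncomputable def A : S := theta (X ^ 2) (X ^ 1)
/-- `φ(-q)` -/
noncomputable def h : S := theta (-X ^ 1) (-X ^ 1)
/-- `Ω(-q)` -/
noncomputable def w : S := theta (-X ^ 5) (-X ^ 1)
/-- `φ(-q²)` -/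
noncomputable def h2 : S := theta (-X ^ 2) (-X ^ 2)

theorem Ng_s : Ng s = p := by
  rw [s, p, Ng_theta (X_dvd_npow (by norm_num)) (X_dvd_npow (by norm_num)), map_neg, map_neg,
    Ng_X_pow, Ng_X_pow]
  norm_num

theorem dis_p : p = A ^ 3 + X * p ^ 9 := by
  apply eq_of_dvd
  intro N
  have gp := goodT_tt (X_dvd_pow (r := 3) (by norm_num)) (X_dvd_pow (r := 1) (by norm_num))
  have gA := goodT_tt (X_dvd_pow (r := 2) (by norm_num)) (X_dvd_pow (r := 1) (by norm_num))
  have k1 := sm_congr gp (N := N) (A := Icc (-(3 * (N : ℤ) + 1)) (3 * N + 1))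
    (Icc_subset_Icc (by omega) (by omega))
  have k2 := dvd_cube (sm_congr gA (N := N) (A := Icc (-(2 * (N : ℤ) + 1)) (2 * N))
    (Icc_subset_Icc (by omega) (by omega)))
  have k3 := (dvd_cube (dvd_cube (sm_congr gp (subset_refl (Icc (-(N : ℤ)) N))))).mul_left X
  rw [split3] at k1
  rw [split2, sum_cube] at k2
  rw [sum_cube, sum_cube, ← pow_mul] at k3
  refine dvd_trans_sub k1 ?_
  rw [← dvd_neg, neg_sub]
  have := dvd_add k2 k3
  convert this using 1
  rw [p, A, theta, theta, mul_sub, mul_sum, ← add_sub_add_comm,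
    ← sum_add_distrib]
  congr 1
  apply sum_congr rfl
  intro j _
  rw [add_cube]
  simp only [tt_pos, ← pow_mul, ← pow_succ']
  have t1 := tri_cast (3 * j)
  have t2 := tri_cast (3 * j - 1)
  have t3 := tri_cast (3 * j + 1)
  have t4 := tri_cast (3 * j + 1 - 1)
  have t5 := tri_cast (-(3 * j + 1))
  have t6 := tri_cast (-(3 * j + 1) - 1)
  have t7 := tri_cast (2 * j)
  have t8 := tri_cast (2 * j - 1)
  have t9 := tri_cast (-(2 * j + 1))
  have t10 := tri_cast (-(2 * j + 1) - 1)
  have t11 := tri_cast j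
  have t12 := tri_cast (j - 1)
  congr 1
  · congr 1
    · congr 1; zify; linarith
    · congr 1; zify; linarith
  · congr 1; zify; linarith

theorem dis_h : h = h ^ 9 + X * w ^ 3 := by
  apply eq_of_dvd
  intro N
  have gh := goodT_tt (X_dvd_npow (r := 1) (by norm_num)) (X_dvd_npow (r := 1) (by norm_num))
  have gw := goodT_tt (X_dvd_npow (r := 5) (by norm_num)) (X_dvd_npow (r := 1) (by norm_num))
  have k1 := sm_congr gh (N := N) (A := Icc (-(3 * (N : ℤ) + 1)) (3 * N + 1))
    (Icc_subset_Icc (by omega) (by omega))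
  have k2 := (dvd_cube (sm_congr gw (subset_refl (Icc (-(N : ℤ)) N)))).mul_left X
  have k3 := (dvd_cube (dvd_cube (sm_congr gh (subset_refl (Icc (-(N : ℤ)) N)))))
  rw [split3] at k1
  rw [sum_cube] at k2
  rw [sum_cube, sum_cube, ← pow_mul] at k3
  refine dvd_trans_sub k1 ?_
  rw [← dvd_neg, neg_sub]
  have := dvd_add k3 k2
  convert this using 1
  rw [h, w, theta, theta, mul_sub, mul_sum, ← add_sub_add_comm,
    ← sum_add_distrib]
  congr 1
  apply sum_congr rfl
  intro j _
  simp only [tt_neg, mul_pow, ← pow_mul, sg_3, sg_31, sg_32]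
  have sg9 : sg j ^ (3 * 3) = sg j := by rw [pow_mul, sg_cube, sg_cube]
  simp only [sg9, sg_cube]
  have t1 := tri_cast (3 * j)
  have t2 := tri_cast (3 * j - 1)
  have t3 := tri_cast (3 * j + 1)
  have t4 := tri_cast (3 * j + 1 - 1)
  have t5 := tri_cast (-(3 * j + 1))
  have t6 := tri_cast (-(3 * j + 1) - 1)
  have t11 := tri_cast j
  have t12 := tri_cast (j - 1)
  have e1 : 1 * tri (3 * j) + 1 * tri (3 * j - 1) = (1 * tri j + 1 * tri (j - 1)) * (3 * 3) := by
    zify; linarith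
  have e2 : 1 * tri (3 * j + 1) + 1 * tri (3 * j + 1 - 1)
      = 1 + (5 * tri j + 1 * tri (j - 1)) * 3 := by
    zify; linarith
  have e3 : 1 * tri (-(3 * j + 1)) + 1 * tri (-(3 * j + 1) - 1)
      = 1 + (5 * tri j + 1 * tri (j - 1)) * 3 := by
    zify; linarith
  have h3 : (3 : S) = 0 := CharP.cast_eq_zero S 3
  rw [e1, e2, e3, pow_add, pow_one]
  linear_combination -sg j * X * X ^ ((5 * tri j + 1 * tri (j - 1)) * 3) * h3

/-- indicator of residue class -/
def ind (d r : ℕ) : ℕ → ℕ := fun n => if n % d = r % d then 1 else 0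

theorem P_eu (d : ℕ) (hd : 1 ≤ d) : P (fun k => 1 - (X ^ d) ^ (k+1)) = m (ind d 0) := by
  have := reindex' d d hd le_rfl
  rw [Nat.mod_self] at this
  unfold ind
  rw [Nat.zero_mod, ← this]
  congr 1
  funext k
  rw [← pow_mul]
  ring_nf

theorem P_neg (d r : ℕ) (hr : 1 ≤ r) (hd : r ≤ d) :
    P (fun k => 1 + (-X ^ r) * (X ^ d) ^ k) = m (ind d r) := by
  unfold ind
  rw [← reindex' d r hr hd]
  congr 1
  funext k
  rw [← pow_mul, pow_add]
  ring

theorem P_pos (d r : ℕ) (hr : 1 ≤ r) (hd : r ≤ d) :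
    P (fun k => 1 + X ^ r * (X ^ d) ^ k) * m (ind d r) = m (ind (2 * d) (2 * r)) := by
  rw [← P_neg d r hr hd, ← P_mul]
  · unfold ind
    rw [← reindex' (2 * d) (2 * r) (by omega) (by omega)]
    congr 1
    funext k
    rw [pow_add, mul_assoc, pow_mul' _ 2, pow_mul' X 2 r, ← pow_mul]
    ring
  · exact good_1 (X_dvd_pow hr) (X_dvd_pow (by omega))
  · exact good_1 (X_dvd_npow hr) (X_dvd_pow (by omega))

theorem theta_neg (r t : ℕ) (hr : 1 ≤ r) (ht : 1 ≤ t) :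
    theta (-X ^ r) (-X ^ t) =
      m (ind (r + t) 0) * m (ind (r + t) t) * m (ind (r + t) r) := by
  rw [jtp (X_dvd_npow hr) (X_dvd_npow ht), neg_mul_neg, ← pow_add, P_eu _ (by omega),
    P_neg _ _ ht (by omega), P_neg _ _ hr (by omega)]

end BT

namespace BT

open Finset

/-- dissection operator -/
noncomputable def U (r : ℕ) (F : S) : S := PowerSeries.mk fun n => coeff (3 * n + r) F

theorem U_add (r : ℕ) (F G : S) : U r (F + G) = U r F + U r G := by
  ext n; simp [U]

theorem U_sub (r : ℕ) (F G : S) : U r (F - G) = U r F - U r G := by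
  ext n; simp [U]

theorem coeff_cube (F : S) (n : ℕ) :
    coeff n (F ^ 3) = if 3 ∣ n then coeff (n / 3) F else 0 := by
  have h1 : (X : S) ^ (n+1) ∣ F - ((trunc (n+1) F : Polynomial (ZMod 3)) : S) := by
    rw [X_pow_dvd_iff]
    intro k hk
    rw [map_sub, Polynomial.coeff_coe, coeff_trunc, if_pos hk, sub_self]
  have h2 := X_pow_dvd_iff.mp (dvd_cube h1) n (by omega)
  rw [map_sub, sub_eq_zero] at h2
  rw [h2, ← Polynomial.coe_pow, ← ZMod.expand_card, Polynomial.coeff_coe,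
    Polynomial.coeff_expand (by norm_num)]
  split_ifs with h
  · rw [coeff_trunc, if_pos]
    have := Nat.div_le_self n 3
    omega
  · rfl

theorem U_mul (r : ℕ) (hr : r < 3) (F G : S) : U r (F ^ 3 * G) = F * U r G := by
  ext n
  rw [U, coeff_mk, coeff_mul, coeff_mul]
  symm
  refine sum_of_injOn (fun x : ℕ × ℕ => (3 * x.1, 3 * x.2 + r)) ?_ ?_ ?_ ?_
  · rintro ⟨a, b⟩ _ ⟨c, d⟩ _ h
    simp only [Prod.mk.injEq] at h ⊢
    omega
  · rintro ⟨a, b⟩ hx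
    simp only [mem_coe, HasAntidiagonal.mem_antidiagonal] at hx ⊢
    omega
  · rintro ⟨a, b⟩ hx hn
    simp only [HasAntidiagonal.mem_antidiagonal] at hx
    simp only [coeff_cube]
    rw [if_neg, zero_mul]
    intro hd
    apply hn
    refine ⟨(a / 3, n - a / 3), ?_, ?_⟩
    · simp only [mem_coe, HasAntidiagonal.mem_antidiagonal]
      omega
    · simp only [Prod.mk.injEq]
      omega
  · rintro ⟨a, b⟩ hx
    simp only [coeff_cube, U, coeff_mk]
    rw [if_pos (by omega), Nat.mul_div_cancel_left _ (by norm_num)]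

theorem U_Xpow (r k : ℕ) (h : k < 3) (hr : r < 3) : U r (X ^ k) = if r = k then 1 else 0 := by
  ext n
  rw [U, coeff_mk, coeff_X_pow]
  split_ifs with h1 h2 h2
  · rw [coeff_one, if_pos (by omega)]
  · omega
  · rw [coeff_one, if_neg (by omega)]
  · simp

theorem U_cX (r k : ℕ) (h : k < 3) (hr : r < 3) (F : S) :
    U r (F ^ 3 * X ^ k) = if r = k then F else 0 := by
  rw [U_mul r hr, U_Xpow r k h hr]
  split_ifs <;> simp

theorem U_c (r : ℕ) (hr : r < 3) (F : S) : U r (F ^ 3) = if r = 0 then F else 0 := by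
  have := U_cX r 0 (by norm_num) hr F
  rwa [pow_zero, mul_one] at this

/-- eta -/
noncomputable def f (k : ℕ) : S := m (ind k 0)

/-- `(q;q²)` -/
noncomputable def O : S := m (ind 2 1)

theorem f_ne (k : ℕ) : f k ≠ 0 := m_ne _

theorem O_f2 : O * f 2 = f 1 := by
  unfold O f
  rw [m_add]
  congr 1
  funext n
  simp only [ind]
  split_ifs <;> omega

theorem s_eq : s = f 4 * O := by
  rw [s, theta_neg 3 1 (by norm_num) (by norm_num), mul_assoc]
  unfold O f
  congr 1
  rw [m_add]
  congr 1
  funext n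
  simp only [ind]
  split_ifs <;> omega

theorem h_eq : h = f 2 * O ^ 2 := by
  rw [h, theta_neg 1 1 (by norm_num) (by norm_num), mul_assoc, ← pow_two]
  rfl

theorem h2_eq : h2 * f 4 = f 2 ^ 2 := by
  rw [h2, theta_neg 2 2 (by norm_num) (by norm_num)]
  unfold f
  rw [pow_two, m_add, m_add, m_add, m_add]
  congr 1
  funext n
  simp only [ind]
  split_ifs <;> omega

theorem w_eq : w * f 1 ^ 2 = f 2 ^ 5 := by
  have e : w * f 2 * f 1 ^ 3 = f 1 * (f 2 ^ 3) ^ 2 := by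
    rw [w, theta_neg 5 1 (by norm_num) (by norm_num)]
    unfold f
    rw [m_cube, m_cube, pow_two, m_add, m_add, m_add, m_add, m_add, m_add]
    congr 1
    funext n
    simp only [ind]
    split_ifs <;> omega
  apply mul_right_cancel₀ (mul_ne_zero (f_ne 1) (f_ne 2))
  linear_combination e

theorem A_eq : A * O = h ^ 3 := by
  have e : A * m (ind 3 1) * m (ind 3 2) = m (ind 3 0) * m (ind 6 2) * m (ind 6 4) := by
    have h1 := P_pos 3 1 (by norm_num) (by norm_num)
    have h2 := P_pos 3 2 (by norm_num) (by norm_num)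
    rw [A, jtp (X_dvd_pow (by norm_num)) (X_dvd_pow (by norm_num)), ← pow_add,
      P_eu _ (by norm_num)]
    norm_num at h1 h2 ⊢
    rw [← h1, ← h2]
    ring
  have e2 : m (ind 3 0) * m (ind 6 2) * m (ind 6 4) * O
      = m (ind 3 1) * m (ind 3 2) * (f 2 ^ 3 * (O ^ 3 * O ^ 3)) := by
    unfold f O
    rw [m_cube, m_cube]
    simp only [m_add]
    congr 1
    funext n
    simp only [ind]
    split_ifs <;> omega
  rw [h_eq]
  apply mul_right_cancel₀ (mul_ne_zero (m_ne (ind 3 1)) (m_ne (ind 3 2)))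
  linear_combination O * e + e2

theorem As : A * s = f 4 * h ^ 3 := by
  rw [s_eq, ← A_eq]; ring

theorem Ng_f4 : Ng (f 4) = f 4 := by
  unfold f m
  rw [Ng_P (good_m _)]
  congr 1
  funext k
  rw [map_pow, map_sub, map_one, Ng_X_pow]
  by_cases h : (k + 1) % 4 = 0
  · rw [Even.neg_one_pow (by rw [Nat.even_iff]; omega), one_mul]
  · simp [ind, h]

theorem p_eq : p = f 4 * Ng O := by
  rw [← Ng_s, s_eq, map_mul, Ng_f4]

theorem Ng_O : Ng O * O = m (ind 4 2) := by
  unfold O m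
  rw [Ng_P (good_m _), ← P_mul (good_m _).ng (good_m _)]
  have := reindex 2 2 (by norm_num) le_rfl (fun k => ind 2 1 (k+1))
  have e : P (fun k => (1 - X ^ (2 * k + 2)) ^ ind 2 1 (k+1)) =
      P (fun k => Ng ((1 - X ^ (k+1)) ^ ind 2 1 (k+1)) * (1 - X ^ (k+1)) ^ ind 2 1 (k+1)) := by
    congr 1
    funext k
    rw [map_pow, map_sub, map_one, Ng_X_pow]
    by_cases h : (k + 1) % 2 = 1
    · rw [Odd.neg_one_pow (by rw [Nat.odd_iff]; omega), ← mul_pow]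
      congr 1
      ring
    · simp [ind, h]
  rw [← e, this, m]
  congr 1
  funext k
  congr 1
  simp only [ind]
  split_ifs <;> omega

theorem p_f1 : p * f 1 = f 2 ^ 2 := by
  have e : f 4 * m (ind 4 2) = f 2 := by
    unfold f
    rw [m_add]
    congr 1
    funext n
    simp only [ind]
    split_ifs <;> omega
  rw [p_eq, ← O_f2]
  linear_combination f 4 * f 2 * Ng_O + f 2 * e

theorem p_ne : p ≠ 0 := by
  intro h
  have := p_f1
  rw [h, zero_mul] at this
  exact pow_ne_zero 2 (f_ne 2) this.symm

theorem s_ne : s ≠ 0 := by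
  rw [s_eq]
  exact mul_ne_zero (f_ne 4) (m_ne _)

theorem was : w * Ng A * s = h2 * (f 4 * Ng h) ^ 3 := by
  have e1 : Ng A * p = f 4 * Ng h ^ 3 := by
    have := congrArg Ng As
    rwa [map_mul, map_mul, Ng_s, Ng_f4, map_pow] at this
  have e2 : s * f 2 = f 4 * f 1 := by rw [s_eq, ← O_f2]; ring
  have e3 := p_f1
  have e4 := w_eq
  have e5 := h2_eq
  -- multiply by p f1 * f1^2 * f2
  apply mul_right_cancel₀ (mul_ne_zero p_ne (mul_ne_zero (pow_ne_zero 3 (f_ne 1)) (f_ne 2)))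
  calc w * Ng A * s * (p * (f 1 ^ 3 * f 2))
      = (w * f 1 ^ 2) * (Ng A * p) * (s * f 2) * f 1 := by ring
    _ = f 2 ^ 5 * (f 4 * Ng h ^ 3) * (f 4 * f 1) * f 1 := by rw [e4, e1, e2]
    _ = f 2 ^ 2 * f 4 ^ 2 * Ng h ^ 3 * f 1 ^ 2 * f 2 * f 2 ^ 2 := by ring
    _ = (h2 * f 4) * f 4 ^ 2 * Ng h ^ 3 * f 1 ^ 2 * f 2 * (p * f 1) := by rw [e5, e3]
    _ = _ := by ring

theorem U1_h2 : U 1 h2 = 0 := by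
  ext n
  rw [U, coeff_mk, h2, theta, sm, coeff_mk, map_sum, map_zero]
  apply sum_eq_zero
  intro j _
  rw [tt_neg, ← mul_add, tri_sum, sg]
  have : 3 * n + 1 ≠ 2 * (j.natAbs * j.natAbs) := by
    intro h
    have h3 : j.natAbs % 3 = 0 ∨ j.natAbs % 3 = 1 ∨ j.natAbs % 3 = 2 := by omega
    have h4 : (2 * (j.natAbs * j.natAbs)) % 3 = 1 := by omega
    rcases h3 with h3 | h3 | h3 <;> simp [Nat.mul_mod, h3] at h4
  split_ifs
  · rw [one_mul, coeff_X_pow, if_neg this]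
  · rw [neg_one_mul, map_neg, coeff_X_pow, if_neg this, neg_zero]

theorem dis_s : s = Ng A ^ 3 - X * s ^ 9 := by
  have h1 : Ng p = s := by
    rw [s, p, Ng_theta (X_dvd_pow (by norm_num)) (X_dvd_pow (by norm_num)),
      Ng_X_pow, Ng_X_pow]
    norm_num
  have := congrArg Ng dis_p
  rw [map_add, map_mul, map_pow, map_pow, h1, ← pow_one X, Ng_X_pow] at this
  linear_combination this

theorem main_S (B : S) (hB : B * f 4 ^ 3 = p) :
    U 1 (U 2 (U 2 (U 0 B))) = - U 2 (U 0 B) := by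
  set C := U 0 B with hC
  have c1 : f 4 * C = A := by
    rw [hC, ← U_mul 0 (by norm_num), mul_comm, hB, dis_p, U_add, U_c _ (by norm_num),
      show X * p ^ 9 = (p ^ 3) ^ 3 * X ^ 1 by ring, U_cX _ _ (by norm_num) (by norm_num)]
    simp
  have c2 : C * s = h ^ 3 := by
    apply mul_left_cancel₀ (f_ne 4)
    rw [← As, ← c1]; ring
  set a := Ng A with ha
  have hs2 : U 2 (s ^ 2) = s ^ 6 := by
    have : s ^ 2 = (a ^ 2) ^ 3 - (a * s ^ 3) ^ 3 * X ^ 1 - (a * s ^ 3) ^ 3 * X ^ 1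
        + (s ^ 6) ^ 3 * X ^ 2 := by
      conv_lhs => rw [dis_s]
      ring
    rw [this, U_add, U_sub, U_sub, U_c _ (by norm_num), U_cX _ _ (by norm_num) (by norm_num),
      U_cX _ _ (by norm_num) (by norm_num)]
    simp
  have hD : U 2 C = h * s ^ 5 := by
    apply mul_left_cancel₀ s_ne
    rw [← U_mul 2 (by norm_num), show s ^ 3 * C = h ^ 3 * s ^ 2 by rw [← c2]; ring,
      U_mul 2 (by norm_num), hs2]
    ring
  have h3 : (3 : S) = 0 := CharP.cast_eq_zero S 3
  have hU2 : U 2 (h * s ^ 2) = h ^ 3 * s ^ 6 + w * a * s ^ 3 := by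
    have : h * s ^ 2 = (h ^ 3 * a ^ 2) ^ 3 + (h ^ 3 * a * s ^ 3) ^ 3 * X ^ 1
        + (w * a ^ 2) ^ 3 * X ^ 1
        + (h ^ 3 * s ^ 6 + w * a * s ^ 3) ^ 3 * X ^ 2 + (X * w * s ^ 6) ^ 3 := by
      rw [add_cube]
      have e1 := dis_s
      have e2 := dis_h
      calc h * s ^ 2 = (h ^ 9 + X * w ^ 3) * (a ^ 3 - X * s ^ 9) ^ 2 := by rw [← e1, ← e2]
        _ = _ := by
          linear_combination (- h ^ 9 * a ^ 3 * X * s ^ 9 - X ^ 2 * w ^ 3 * a ^ 3 * s ^ 9) * h3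
    rw [this]
    simp only [U_add]
    rw [U_c _ (by norm_num), U_c _ (by norm_num), U_cX _ _ (by norm_num) (by norm_num),
      U_cX _ _ (by norm_num) (by norm_num), U_cX _ _ (by norm_num) (by norm_num)]
    simp
  have hU1s : U 1 s = - s ^ 3 := by
    have : s = a ^ 3 - (s ^ 3) ^ 3 * X ^ 1 := by
      conv_lhs => rw [dis_s]
      ring
    rw [this, U_sub, U_c _ (by norm_num), U_cX _ _ (by norm_num) (by norm_num), ← this]
    simp
  have hU22 : U 2 (U 2 C) = h ^ 3 * ((s ^ 2) ^ 3 * s) + s ^ 3 * (w * a * s) := by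
    rw [hD, show h * s ^ 5 = s ^ 3 * (h * s ^ 2) by ring, U_mul 2 (by norm_num), hU2]
    ring
  rw [hU22, hD, U_add, U_mul 1 (by norm_num), U_mul 1 (by norm_num), U_mul 1 (by norm_num),
    hU1s, was, mul_comm h2, U_mul 1 (by norm_num), U1_h2]
  ring

end BT

namespace BT

open Finset

section conv
variable {α β : Type} (u : α → ℕ) (v : β → ℕ)

/-- fibre decomposition of a product -/
def convEquiv (n : ℕ) : {x : α × β // u x.1 + v x.2 = n} ≃
    Σ ij : {ij : ℕ × ℕ // ij ∈ Finset.HasAntidiagonal.antidiagonal n},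
      {a : α // u a = ij.1.1} × {b : β // v b = ij.1.2} where
  toFun x := ⟨⟨(u x.1.1, v x.1.2), by simpa using x.2⟩, ⟨x.1.1, rfl⟩, ⟨x.1.2, rfl⟩⟩
  invFun y := ⟨(y.2.1.1, y.2.2.1), by
    rw [y.2.1.2, y.2.2.2]; exact Finset.HasAntidiagonal.mem_antidiagonal.mp y.1.2⟩
  left_inv x := rfl
  right_inv := by
    rintro ⟨⟨⟨i, j⟩, hij⟩, ⟨a, ha⟩, ⟨b, hb⟩⟩
    dsimp at ha hb
    subst ha hb
    rfl

theorem conv_finite (hu : ∀ n, Finite {a : α // u a = n}) (hv : ∀ n, Finite {b : β // v b = n})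
    (n : ℕ) : Finite {x : α × β // u x.1 + v x.2 = n} :=
  Finite.of_equiv _ (convEquiv u v n).symm

theorem conv_card (hu : ∀ n, Finite {a : α // u a = n}) (hv : ∀ n, Finite {b : β // v b = n})
    (n : ℕ) : Nat.card {x : α × β // u x.1 + v x.2 = n} =
      ∑ ij ∈ Finset.HasAntidiagonal.antidiagonal n,
        Nat.card {a : α // u a = ij.1} * Nat.card {b : β // v b = ij.2} := by
  rw [Nat.card_congr (convEquiv u v n), Nat.card_sigma]
  simp only [Nat.card_prod]
  exact Finset.sum_coe_sort (Finset.HasAntidiagonal.antidiagonal n)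
    (fun ij => Nat.card {a : α // u a = ij.1} * Nat.card {b : β // v b = ij.2})

/-- generating series of a weight -/
noncomputable def gs (u : α → ℕ) : S :=
  PowerSeries.mk fun n => ((Nat.card {a : α // u a = n} : ℕ) : ZMod 3)

theorem gs_conv (hu : ∀ n, Finite {a : α // u a = n}) (hv : ∀ n, Finite {b : β // v b = n}) :
    gs (fun x : α × β => u x.1 + v x.2) = gs u * gs v := by
  ext n
  rw [coeff_mul, gs, coeff_mk, conv_card u v hu hv]
  simp [gs]

end conv

/-- multisets versus partitions -/
def partEquiv (q : Multiset ℕ → Prop) (hq : ∀ t, q t → ∀ x ∈ t, 0 < x) (n : ℕ) :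
    {a : {t : Multiset ℕ // q t} // a.1.sum = n} ≃ {x : n.Partition // q x.parts} where
  toFun a := ⟨⟨a.1.1, fun {i} hi => hq _ a.1.2 i hi, a.2⟩, a.1.2⟩
  invFun x := ⟨⟨x.1.parts, x.2⟩, x.1.parts_sum⟩
  left_inv _ := rfl
  right_inv _ := rfl

theorem part_finite (q : Multiset ℕ → Prop) (hq : ∀ t, q t → ∀ x ∈ t, 0 < x) (n : ℕ) :
    Finite {a : {t : Multiset ℕ // q t} // a.1.sum = n} :=
  Finite.of_equiv _ (partEquiv q hq n).symm

open scoped Classical in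
theorem part_card (q : Multiset ℕ → Prop) (hq : ∀ t, q t → ∀ x ∈ t, 0 < x) (n : ℕ) :
    Nat.card {a : {t : Multiset ℕ // q t} // a.1.sum = n} =
      #{x : n.Partition | q x.parts} := by
  rw [Nat.card_congr (partEquiv q hq n), Nat.card_eq_fintype_card, Fintype.card_subtype]

/-- distinct odd parts -/
def q1 (t : Multiset ℕ) : Prop := t.Nodup ∧ ∀ x ∈ t, Odd x
/-- parts divisible by four -/
def q4 (t : Multiset ℕ) : Prop := ∀ x ∈ t, 0 < x ∧ 4 ∣ x

theorem q1_pos : ∀ t, q1 t → ∀ x ∈ t, 0 < x := fun _ h x hx => (h.2 x hx).pos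
theorem q4_pos : ∀ t, q4 t → ∀ x ∈ t, 0 < x := fun _ h x hx => (h x hx).1

/-- reorganize triples -/
def tripleEquiv (n : ℕ) : {t : Multiset ℕ × Multiset ℕ × Multiset ℕ //
    t.1.sum + t.2.1.sum + t.2.2.sum = n ∧
    t.1.Nodup ∧ (∀ x ∈ t.1, Odd x) ∧
    (∀ x ∈ t.2.1, 0 < x ∧ 4 ∣ x) ∧
    (∀ x ∈ t.2.2, 0 < x ∧ 4 ∣ x)} ≃
    {x : ({t // q1 t} × {t // q4 t}) × {t // q4 t} //
      (x.1.1.1.sum + x.1.2.1.sum) + x.2.1.sum = n} where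
  toFun t := ⟨((⟨t.1.1, t.2.2.1, t.2.2.2.1⟩, ⟨t.1.2.1, t.2.2.2.2.1⟩), ⟨t.1.2.2, t.2.2.2.2.2⟩), t.2.1⟩
  invFun x := ⟨(x.1.1.1.1, x.1.1.2.1, x.1.2.1), x.2, x.1.1.1.2.1, x.1.1.1.2.2, x.1.1.2.2, x.1.2.2⟩
  left_inv _ := rfl
  right_inv _ := rfl

/-- generating function of `bTriple` -/
noncomputable def B : S := PowerSeries.mk fun n => (bTriple n : ZMod 3)

/-- factor one -/
noncomputable def G1 : S := gs (fun t : {t // q1 t} => t.1.sum)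
/-- factor two -/
noncomputable def G4 : S := gs (fun t : {t // q4 t} => t.1.sum)

theorem B_eq : B = G1 * G4 * G4 := by
  have h1 := part_finite q1 q1_pos
  have h4 := part_finite q4 q4_pos
  have e1 := gs_conv (fun t : {t // q1 t} => t.1.sum) (fun t : {t // q4 t} => t.1.sum) h1 h4
  have e2 := gs_conv (fun x : {t // q1 t} × {t // q4 t} => x.1.1.sum + x.2.1.sum)
    (fun t : {t // q4 t} => t.1.sum) (conv_finite _ _ h1 h4) h4
  rw [G1, G4, ← e1, ← e2]
  ext n
  rw [B, gs, coeff_mk, coeff_mk, bTriple, Nat.card_congr (tripleEquiv n)]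

open scoped PowerSeries.WithPiTopology in
theorem eq_P_of_hasProd [TopologicalSpace (ZMod 3)] [T2Space (ZMod 3)] {g : ℕ → S} (hg : Good g)
    {F : S} (h : HasProd g F) : F = P g := by
  ext n
  have h1 := (WithPiTopology.tendsto_iff_coeff_tendsto _ _ _ _).mp h.tendsto_prod_nat n
  refine tendsto_nhds_unique h1 ?_
  apply tendsto_atTop_of_eventually_const (i₀ := n)
  intro M hM
  have := X_pow_dvd_iff.mp (prod_congr_le hg hM) n (by omega)
  rw [map_sub, sub_eq_zero] at this
  rw [P, coeff_mk, this]

open scoped PowerSeries.WithPiTopology in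
theorem G1_eq : G1 = Ng O := by
  letI : TopologicalSpace (ZMod 3) := ⊥
  haveI : DiscreteTopology (ZMod 3) := ⟨rfl⟩
  have hp := Nat.Partition.hasProd_genFun
    (fun i c => if Odd i ∧ c = 1 then (1 : ZMod 3) else 0)
  have e : (fun i : ℕ => 1 + ∑' j : ℕ, (if Odd (i+1) ∧ j + 1 = 1 then (1 : ZMod 3) else 0) •
      (X : S) ^ ((i+1) * (j+1))) = fun i => Ng ((1 - X ^ (i+1)) ^ ind 2 1 (i+1)) := by
    funext i
    rw [tsum_eq_single 0 (by intro j hj; simp [hj]), map_pow, map_sub, map_one, Ng_X_pow]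
    by_cases h : Odd (i+1)
    · rw [h.neg_one_pow]
      have h' := Nat.odd_iff.mp h
      simp [h, ind, h']
    · have h' : ¬ (i+1) % 2 = 1 := fun hh => h (Nat.odd_iff.mpr hh)
      simp [h, ind, h']
  rw [e] at hp
  have := eq_P_of_hasProd (good_m (ind 2 1)).ng hp
  rw [O, m, Ng_P (good_m _), ← this]
  classical
  ext n
  rw [G1, gs, coeff_mk, part_card q1 q1_pos, Nat.Partition.coeff_genFun, card_filter,
    Nat.cast_sum]
  apply Finset.sum_congr rfl
  intro x _
  rw [Finsupp.prod, Finset.prod_ite_zero, Finset.prod_const_one, Nat.cast_ite, Nat.cast_one,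
    Nat.cast_zero]
  congr 1
  simp only [Multiset.toFinsupp_support, Multiset.mem_toFinset, Multiset.toFinsupp_apply, q1,
    eq_iff_iff]
  constructor
  · rintro ⟨h1, h2⟩ i hi
    exact ⟨h2 i hi, Multiset.count_eq_one_of_mem h1 hi⟩
  · intro h
    refine ⟨?_, fun i hi => (h i hi).1⟩
    rw [Multiset.nodup_iff_count_eq_one]
    exact fun i hi => (h i hi).2

open scoped PowerSeries.WithPiTopology in
theorem G4_eq : G4 * f 4 = 1 := by
  letI : TopologicalSpace (ZMod 3) := ⊥
  haveI : DiscreteTopology (ZMod 3) := ⟨rfl⟩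
  have hp := Nat.Partition.hasProd_powerSeriesMk_card_restricted (ZMod 3) (fun i => 4 ∣ i)
  have e : ∀ k : ℕ, (if 4 ∣ k + 1 then ∑' j : ℕ, (X : S) ^ ((k + 1) * j) else 1) *
      (1 - X ^ (k+1)) ^ ind 4 0 (k+1) = 1 := by
    intro k
    by_cases h : 4 ∣ k + 1
    · rw [if_pos h]
      have h' : (k+1) % 4 = 0 := by omega
      simp only [ind, h', Nat.zero_mod, if_true, pow_one, pow_mul]
      exact WithPiTopology.tsum_pow_mul_one_sub_of_constantCoeff_eq_zero (by simp)
    · have h' : ¬ (k+1) % 4 = 0 := by omega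
      simp [ind, h, h']
  have hg : Good (fun k : ℕ => if 4 ∣ k + 1 then ∑' j : ℕ, (X : S) ^ ((k + 1) * j) else 1) := by
    intro k
    have h1 := good_m (ind 4 0) k
    have h2 := e k
    set g := (if 4 ∣ k + 1 then ∑' j : ℕ, (X : S) ^ ((k + 1) * j) else 1)
    have : g - 1 = - (g * ((1 - X ^ (k+1)) ^ ind 4 0 (k+1) - 1)) := by
      rw [mul_sub, h2]; ring
    rw [this, dvd_neg]
    exact h1.mul_left _
  have h3 := eq_P_of_hasProd hg hp
  have h4 : G4 = PowerSeries.mk fun n => (#(Nat.Partition.restricted n (fun i => 4 ∣ i)) : ZMod 3) := by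
    classical
    ext n
    rw [G4, gs, coeff_mk, coeff_mk, part_card q4 q4_pos]
    congr 2
    unfold Nat.Partition.restricted
    ext x
    refine Finset.mem_filter.trans (Iff.trans ?_ Finset.mem_filter.symm)
    simp only [mem_univ, true_and, q4]
    exact ⟨fun h i hi => (h i hi).2, fun h i hi => ⟨x.parts_pos hi, h i hi⟩⟩
  rw [h4, h3, f, m, ← P_mul hg (good_m _)]
  simp only [e]
  ext n
  simp [P]

theorem B_main : B * f 4 ^ 3 = p := by
  rw [B_eq, p_eq, G1_eq]
  linear_combination (Ng O * f 4 * (G4 * f 4 + 1)) * G4_eq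

end BT

/-- `b(81n+51) ≡ -b(9n+6) (mod 3)` for all `n ≥ 0`. -/
theorem bTriple_81n_add_51_congruence (n : ℕ) :
    (bTriple (81 * n + 51) : ℤ) ≡ -(bTriple (9 * n + 6) : ℤ) [ZMOD 3] := by
  have h := congrArg (coeff n) (BT.main_S BT.B BT.B_main)
  simp only [BT.U, BT.B, coeff_mk, map_neg] at h
  apply (ZMod.intCast_eq_intCast_iff _ _ 3).mp
  push_cast
  rw [show 81 * n + 51 = 3 * (3 * (3 * (3 * n + 1) + 2) + 2) + 0 by ring,
    show 9 * n + 6 = 3 * (3 * n + 2) + 0 by ring]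
  exact h
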